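/- Every type-1 configuration of [2,2,1] admits a proper 5-coloring. -/

import Mathlib

/-- A cuboid with integer root and integer dimensions. -/
structure Cuboid where
  root : ℤ × ℤ × ℤ
  dims : ℤ × ℤ × ℤ
deriving DecidableEq

namespace Cuboid

/-- The dimensions are positive. -/
def valid (C : Cuboid) : Prop :=
  0 < C.dims.1 ∧ 0 < C.dims.2.1 ∧ 0 < C.dims.2.2

/-- The closed cuboid `[x,x+a] × [y,y+b] × [z,z+c] ⊆ ℝ³`. -/
def toSet (C : Cuboid) : Set (ℝ × ℝ × ℝ) :=
  {p | (C.root.1 : ℝ) ≤ p.1 ∧ p.1 ≤ C.root.1 + C.dims.1 ∧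
       (C.root.2.1 : ℝ) ≤ p.2.1 ∧ p.2.1 ≤ C.root.2.1 + C.dims.2.1 ∧
       (C.root.2.2 : ℝ) ≤ p.2.2 ∧ p.2.2 ≤ C.root.2.2 + C.dims.2.2}

/-- The open cuboid `(x,x+a) × (y,y+b) × (z,z+c) ⊆ ℝ³` (the interior). -/
def inte (C : Cuboid) : Set (ℝ × ℝ × ℝ) :=
  {p | (C.root.1 : ℝ) < p.1 ∧ p.1 < C.root.1 + C.dims.1 ∧
       (C.root.2.1 : ℝ) < p.2.1 ∧ p.2.1 < C.root.2.1 + C.dims.2.1 ∧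
       (C.root.2.2 : ℝ) < p.2.2 ∧ p.2.2 < C.root.2.2 + C.dims.2.2}

/-- The set `(ℤ×ℤ×ℝ) ∪ (ℤ×ℝ×ℤ) ∪ (ℝ×ℤ×ℤ)` of grid lines. -/
def grid : Set (ℝ × ℝ × ℝ) :=
  {p | ((∃ m : ℤ, p.1 = m) ∧ (∃ n : ℤ, p.2.1 = n)) ∨
       ((∃ m : ℤ, p.1 = m) ∧ (∃ n : ℤ, p.2.2 = n)) ∨
       ((∃ m : ℤ, p.2.1 = m) ∧ (∃ n : ℤ, p.2.2 = n))}

/-- Two cuboids collide when their interiors intersect. -/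
def Collide (C D : Cuboid) : Prop := (C.inte ∩ D.inte).Nonempty

/-- Two cuboids touch when their interiors are disjoint but their intersection
contains a point outside the grid lines (i.e. it is a non-degenerate rectangle). -/
def Touch (C D : Cuboid) : Prop :=
  ¬ Collide C D ∧ ∃ p ∈ C.toSet ∩ D.toSet, p ∉ grid

end Cuboid

/-- A configuration: a finite family of valid pairwise non-colliding cuboids. -/
def IsConfig (F : Finset Cuboid) : Prop :=
  (∀ C ∈ F, C.valid) ∧ ∀ C ∈ F, ∀ D ∈ F, C ≠ D → ¬ Cuboid.Collide C D

/-- A type-1 configuration of `[a,b,c]`: every cuboid has dimensions exactly `(a,b,c)`. -/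
def Type1 (a b c : ℕ) (F : Finset Cuboid) : Prop :=
  ∀ C ∈ F, C.dims = ((a : ℤ), (b : ℤ), (c : ℤ))

/-- A type-2 configuration of `[a,b,c]`: every cuboid has dimensions `(a,b,c)` or `(b,a,c)`. -/
def Type2 (a b c : ℕ) (F : Finset Cuboid) : Prop :=
  ∀ C ∈ F, C.dims = ((a : ℤ), (b : ℤ), (c : ℤ)) ∨ C.dims = ((b : ℤ), (a : ℤ), (c : ℤ))

/-- A type-3 configuration of `[a,b,c]`: every cuboid's dimensions are a permutation of `(a,b,c)`. -/
def Type3 (a b c : ℕ) (F : Finset Cuboid) : Prop :=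
  ∀ C ∈ F, C.dims = ((a : ℤ), (b : ℤ), (c : ℤ)) ∨ C.dims = ((a : ℤ), (c : ℤ), (b : ℤ)) ∨
    C.dims = ((b : ℤ), (a : ℤ), (c : ℤ)) ∨ C.dims = ((b : ℤ), (c : ℤ), (a : ℤ)) ∨
    C.dims = ((c : ℤ), (a : ℤ), (b : ℤ)) ∨ C.dims = ((c : ℤ), (b : ℤ), (a : ℤ))

/-- A proper `k`-coloring of a configuration: touching cuboids get distinct colors. -/
def ProperColoring (k : ℕ) (F : Finset Cuboid) : Prop :=
  ∃ κ : Cuboid → Fin k, ∀ C ∈ F, ∀ D ∈ F, Cuboid.Touch C D → κ C ≠ κ D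

namespace Cuboid

/-- If two `2 × 2 × 1` cuboids touch, their roots differ by `2` in one horizontal direction, or
by `1` vertically, and less than the side lengths in the two other directions. -/
lemma root_sub_root_of_touch {C D : Cuboid} (hC : C.dims = (2, 2, 1)) (hD : D.dims = (2, 2, 1))
    (h : Touch C D) {a b c : ℤ} (ha : D.root.1 = C.root.1 + a)
    (hb : D.root.2.1 = C.root.2.1 + b) (hc : D.root.2.2 = C.root.2.2 + c) :
    (|a| = 2 ∧ |b| ≤ 1 ∧ c = 0) ∨ (|a| ≤ 1 ∧ |b| = 2 ∧ c = 0) ∨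
      (|a| ≤ 1 ∧ |b| ≤ 1 ∧ |c| = 1) := by
  obtain ⟨⟨x, y, z⟩, dC⟩ := C
  obtain ⟨⟨x', y', z'⟩, dD⟩ := D
  obtain rfl : dC = (2, 2, 1) := hC
  obtain rfl : dD = (2, 2, 1) := hD
  obtain rfl : x' = x + a := ha
  obtain rfl : y' = y + b := hb
  obtain rfl : z' = z + c := hc
  obtain ⟨hcol, ⟨p, q, r⟩, ⟨hp, hp'⟩, hgrid⟩ := h
  simp only [toSet, Set.mem_ofPred_eq] at hp hp'
  push_cast at hp hp'
  obtain ⟨h1, h2, h3, h4, h5, h6⟩ := hp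
  obtain ⟨k1, k2, k3, k4, k5, k6⟩ := hp'
  have a1 : a ≤ 2 := by exact_mod_cast (by linarith : (a : ℝ) ≤ 2)
  have a2 : -2 ≤ a := by exact_mod_cast (by linarith : (-2 : ℝ) ≤ a)
  have b1 : b ≤ 2 := by exact_mod_cast (by linarith : (b : ℝ) ≤ 2)
  have b2 : -2 ≤ b := by exact_mod_cast (by linarith : (-2 : ℝ) ≤ b)
  have c1 : c ≤ 1 := by exact_mod_cast (by linarith : (c : ℝ) ≤ 1)
  have c2 : -1 ≤ c := by exact_mod_cast (by linarith : (-1 : ℝ) ≤ c)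
  have hx : |a| = 2 → ∃ m : ℤ, p = m := by
    intro h
    rcases (abs_eq (by norm_num)).1 h with rfl | rfl
    · exact ⟨x + 2, by push_cast at *; linarith⟩
    · exact ⟨x, by push_cast at *; linarith⟩
  have hy : |b| = 2 → ∃ m : ℤ, q = m := by
    intro h
    rcases (abs_eq (by norm_num)).1 h with rfl | rfl
    · exact ⟨y + 2, by push_cast at *; linarith⟩
    · exact ⟨y, by push_cast at *; linarith⟩
  have hz : |c| = 1 → ∃ m : ℤ, r = m := by
    intro h
    rcases (abs_eq (by norm_num)).1 h with rfl | rfl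
    · exact ⟨z + 1, by push_cast at *; linarith⟩
    · exact ⟨z, by push_cast at *; linarith⟩
  have hxy : ¬ (|a| = 2 ∧ |b| = 2) := fun h => hgrid (Or.inl ⟨hx h.1, hy h.2⟩)
  have hxz : ¬ (|a| = 2 ∧ |c| = 1) := fun h => hgrid (Or.inr (Or.inl ⟨hx h.1, hz h.2⟩))
  have hyz : ¬ (|b| = 2 ∧ |c| = 1) := fun h => hgrid (Or.inr (Or.inr ⟨hy h.1, hz h.2⟩))
  have hnear : ¬ (|a| ≤ 1 ∧ |b| ≤ 1 ∧ c = 0) := by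
    rintro ⟨ha, hb, rfl⟩
    obtain ⟨ha1, ha2⟩ := abs_le.1 (show |(a : ℝ)| ≤ 1 by exact_mod_cast ha)
    obtain ⟨hb1, hb2⟩ := abs_le.1 (show |(b : ℝ)| ≤ 1 by exact_mod_cast hb)
    refine hcol ⟨(x + a / 2 + 1, y + b / 2 + 1, z + 1 / 2), ?_, ?_⟩ <;>
      simp only [inte, Set.mem_ofPred_eq] <;> push_cast <;>
      refine ⟨?_, ?_, ?_, ?_, ?_, ?_⟩ <;> linarith
  have ha2 : |a| ≤ 2 := abs_le.2 ⟨a2, a1⟩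
  have hb2 : |b| ≤ 2 := abs_le.2 ⟨b2, b1⟩
  have hc1 : |c| ≤ 1 := abs_le.2 ⟨c2, c1⟩
  have hc0 : |c| = 0 ↔ c = 0 := abs_eq_zero
  have hc := abs_nonneg c
  omega

/-- A `5`-coloring of `ℤ/6 × ℤ/6`. -/
def torusColor : ZMod 6 → ZMod 6 → Fin 5 :=
  ![![0, 4, 4, 2, 2, 0],
    ![3, 1, 1, 2, 2, 3],
    ![3, 1, 0, 0, 4, 3],
    ![2, 2, 0, 0, 4, 4],
    ![2, 2, 3, 3, 1, 1],
    ![0, 4, 3, 3, 1, 0]]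

lemma torusColor_ne : ∀ u v a b : ZMod 6,
    ((a = 2 ∨ a = 3 ∨ a = -2) ∧ (b = -1 ∨ b = 0 ∨ b = 1)) ∨
      ((a = -1 ∨ a = 0 ∨ a = 1) ∧ (b = 2 ∨ b = -2)) →
    torusColor u v ≠ torusColor (u + a) (v + b) := by
  decide +kernel

/-- The color of a cuboid: the doubly `6`-periodic coloring of the plane, shifted by `3` from each
horizontal layer to the next one. -/
def color (C : Cuboid) : Fin 5 :=
  torusColor ((C.root.1 + 3 * C.root.2.2 : ℤ) : ZMod 6) (C.root.2.1 : ZMod 6)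

lemma color_ne_of_touch {C D : Cuboid} (hC : C.dims = (2, 2, 1)) (hD : D.dims = (2, 2, 1))
    (h : Touch C D) : C.color ≠ D.color := by
  obtain ⟨a, ha⟩ : ∃ a, D.root.1 = C.root.1 + a := ⟨_, (add_sub_cancel _ _).symm⟩
  obtain ⟨b, hb⟩ : ∃ b, D.root.2.1 = C.root.2.1 + b := ⟨_, (add_sub_cancel _ _).symm⟩
  obtain ⟨c, hc⟩ : ∃ c, D.root.2.2 = C.root.2.2 + c := ⟨_, (add_sub_cancel _ _).symm⟩
  have hu : ((D.root.1 + 3 * D.root.2.2 : ℤ) : ZMod 6) =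
      ((C.root.1 + 3 * C.root.2.2 : ℤ) : ZMod 6) + ((a + 3 * c : ℤ) : ZMod 6) := by
    rw [ha, hc]; push_cast; ring
  have hv : (D.root.2.1 : ZMod 6) = (C.root.2.1 : ZMod 6) + (b : ZMod 6) := by
    rw [hb]; push_cast; ring
  rw [color, color, hu, hv]
  apply torusColor_ne
  have key := root_sub_root_of_touch hC hD h ha hb hc
  have hc0 : c = 0 → |c| = 0 := abs_eq_zero.2
  obtain ⟨a1, a2⟩ := abs_le.1 (show |a| ≤ 2 by omega)
  obtain ⟨b1, b2⟩ := abs_le.1 (show |b| ≤ 2 by omega)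
  obtain ⟨c1, c2⟩ := abs_le.1 (show |c| ≤ 1 by omega)
  clear ha hb hc hc0 hu hv
  interval_cases a <;> interval_cases b <;> interval_cases c <;>
    first | (exfalso; revert key; decide) | decide

end Cuboid

/-- Every type-1 configuration of `[2,2,1]` admits a proper 5-coloring. -/
theorem type1_221_5colorable :
    ∀ F : Finset Cuboid, IsConfig F → Type1 2 2 1 F → ProperColoring 5 F := by
  intro F _ hF
  exact ⟨Cuboid.color, fun C hC D hD h => Cuboid.color_ne_of_touch (hF C hC) (hF D hD) h⟩
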